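/- (Uniform bound on the massive part.) Let m ∈ ℝ, T > 0, and fix the null-coordinate Dirac system. Suppose u_+, u_− : [−T,T]×ℝ → ℂ are C¹ with u_±(t,·) compactly supported for each t, A_+, A_− : [−T,T]×ℝ → ℝ are continuous, and i(∂_t u_+ + ∂_x u_+) = m u_− − A_− u_+, i(∂_t u_− − ∂_x u_−) = m u_+ − A_+ u_−, with data f_± = u_±(0,·). Suppose further u^N_+, u^N_− : [−T,T]×ℝ → ℂ are C¹ and satisfy i(∂_t u^N_+ + ∂_x u^N_+) = m u_− − A_− u^N_+, i(∂_t u^N_− − ∂_x u^N_−) = m u_+ − A_+ u^N_−, with u^N_±(0,·) = 0. Then there is a constant C = C(T, m) > 0, independent of the solutions and data, such that sup_{|t|≤T} ( ‖u^N_+(t)‖_{L^∞(ℝ)} + ‖u^N_−(t)‖_{L^∞(ℝ)} ) ≤ C ( ‖f_+‖_{L²(ℝ)} + ‖f_−‖_{L²(ℝ)} ). -/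

import Mathlib

noncomputable section

open MeasureTheory
open scoped ENNReal

/-- Energy identity on a backward light cone for a pair of densities `P`, `M` transported
to the right and to the left with opposite source terms. -/
theorem integral_lightCone_sides_eq {P M : ℝ × ℝ → ℝ} (hP : ContDiff ℝ 1 P) (hM : ContDiff ℝ 1 M)
    {t₀ : ℝ} (ht₀ : 0 ≤ t₀)
    (h : ∀ t x : ℝ, t ∈ Set.Icc 0 t₀ → fderiv ℝ P (t, x) (1, 1) + fderiv ℝ M (t, x) (1, -1) = 0)
    (y : ℝ) :
    2 * (∫ t in (0)..t₀, P (t, y + 2 * t₀ - t)) + 2 * (∫ t in (0)..t₀, M (t, y + t))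
      = ∫ x in y..(y + 2 * t₀), (P (0, x) + M (0, x)) := by
  have hPd : Differentiable ℝ P := hP.differentiable one_ne_zero
  have hMd : Differentiable ℝ M := hM.differentiable one_ne_zero
  have hPc := hP.continuous
  have hMc := hM.continuous
  set Φ : ℝ × ℝ → ℝ × ℝ := fun z => (z.1, (y + t₀) + (t₀ - z.1) * z.2) with hΦ
  have hΦd : Differentiable ℝ Φ := by fun_prop
  set f : ℝ × ℝ → ℝ := fun z => (t₀ - z.1) * (P (Φ z) + M (Φ z)) with hf
  set g : ℝ × ℝ → ℝ := fun z => z.2 * (P (Φ z) + M (Φ z)) + (P (Φ z) - M (Φ z)) with hg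
  have hfd : Differentiable ℝ f := by fun_prop
  have hgd : Differentiable ℝ g := by fun_prop
  have hdiv : ∀ z ∈ Set.Icc (0 : ℝ) t₀ ×ˢ Set.Icc (-1 : ℝ) 1,
      fderiv ℝ f z (1, 0) + fderiv ℝ g z (0, 1) = 0 := by
    rintro ⟨t, s⟩ hz
    have l1 : HasDerivAt (fun t' : ℝ => (t', s)) ((1 : ℝ), (0 : ℝ)) t :=
      (hasDerivAt_id t).prodMk (hasDerivAt_const t s)
    have l2 : HasDerivAt (fun s' : ℝ => (t, s')) ((0 : ℝ), (1 : ℝ)) s :=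
      (hasDerivAt_const s t).prodMk (hasDerivAt_id s)
    have c1 : HasDerivAt (fun t' : ℝ => Φ (t', s)) ((1 : ℝ), -s) t := by
      refine (hasDerivAt_id t).prodMk ?_
      simpa using (((hasDerivAt_id t).const_sub t₀).mul_const s).const_add (y + t₀)
    have c2 : HasDerivAt (fun s' : ℝ => Φ (t, s')) ((0 : ℝ), t₀ - t) s := by
      refine (hasDerivAt_const s t).prodMk ?_
      simpa using ((hasDerivAt_id s).const_mul (t₀ - t)).const_add (y + t₀)
    have p1 := (hPd (Φ (t, s))).hasFDerivAt.comp_hasDerivAt t c1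
    have p2 := (hPd (Φ (t, s))).hasFDerivAt.comp_hasDerivAt s c2
    have m1 := (hMd (Φ (t, s))).hasFDerivAt.comp_hasDerivAt t c1
    have m2 := (hMd (Φ (t, s))).hasFDerivAt.comp_hasDerivAt s c2
    have f1 := (hfd (t, s)).hasFDerivAt.comp_hasDerivAt t l1
    have g2 := (hgd (t, s)).hasFDerivAt.comp_hasDerivAt s l2
    have ef := f1.unique
      (((hasDerivAt_id t).const_sub t₀).mul (p1.add m1))
    have eg := g2.unique
      (((hasDerivAt_id s).mul (p2.add m2)).add (p2.sub m2))
    rw [ef, eg]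
    have key := h t ((y + t₀) + (t₀ - t) * s) hz.1
    have expand : ∀ (L : ℝ × ℝ →L[ℝ] ℝ) (a b : ℝ), L (a, b) = a * L (1, 0) + b * L (0, 1) := by
      intro L a b
      have : ((a, b) : ℝ × ℝ) = a • ((1 : ℝ), (0 : ℝ)) + b • ((0 : ℝ), (1 : ℝ)) := by simp
      rw [this, map_add, map_smul, map_smul, smul_eq_mul, smul_eq_mul]
    rw [expand _ 1 1, expand _ 1 (-1)] at key
    simp only [Pi.add_apply, Function.comp_apply, id_eq, hΦ]
    rw [expand _ 1 (-s), expand _ 0 (t₀ - t), expand (fderiv ℝ M _) 1 (-s),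
      expand (fderiv ℝ M _) 0 (t₀ - t)]
    linear_combination (t₀ - t) * key
  have hsub : Set.uIcc (0 : ℝ) t₀ ×ˢ Set.uIcc (-1 : ℝ) 1 = Set.Icc 0 t₀ ×ˢ Set.Icc (-1) 1 := by
    rw [Set.uIcc_of_le ht₀, Set.uIcc_of_le (by norm_num)]
  have main := integral2_divergence_prod_of_hasFDerivAt f g (fderiv ℝ f) (fderiv ℝ g)
    0 (-1) t₀ 1 hfd.continuous.continuousOn hgd.continuous.continuousOn
    (fun z _ => (hfd z).hasFDerivAt) (fun z _ => (hgd z).hasFDerivAt)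
    (by
      rw [hsub]
      exact integrableOn_zero.congr_fun (fun z hz => (hdiv z hz).symm)
        (measurableSet_Icc.prod measurableSet_Icc))
  have hzero : (∫ x in (0)..t₀, ∫ z in (-1)..1,
      fderiv ℝ f (x, z) (1, 0) + fderiv ℝ g (x, z) (0, 1)) = 0 := by
    rw [intervalIntegral.integral_congr (g := fun _ => (0 : ℝ))]
    · simp
    intro x hx
    dsimp only
    rw [intervalIntegral.integral_congr (g := fun _ => (0 : ℝ))]
    · simp
    intro z hz
    exact hdiv (x, z) (hsub ▸ ⟨hx, hz⟩)
  rw [hzero] at main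
  have e1 : (∫ x in (0)..t₀, g (x, 1)) = 2 * ∫ t in (0)..t₀, P (t, y + 2 * t₀ - t) := by
    rw [← intervalIntegral.integral_const_mul]
    refine intervalIntegral.integral_congr fun t _ => ?_
    simp only [hg, hΦ]
    rw [show y + t₀ + (t₀ - t) * 1 = y + 2 * t₀ - t by ring]
    ring
  have e2 : (∫ x in (0)..t₀, g (x, -1)) = -(2 * ∫ t in (0)..t₀, M (t, y + t)) := by
    rw [← intervalIntegral.integral_const_mul, ← intervalIntegral.integral_neg]
    refine intervalIntegral.integral_congr fun t _ => ?_
    simp only [hg, hΦ]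
    rw [show y + t₀ + (t₀ - t) * -1 = y + t by ring]
    ring
  have e3 : (∫ s in (-1)..1, f (t₀, s)) = 0 := by simp [hf]
  have e4 : (∫ s in (-1)..1, f (0, s)) = ∫ x in y..(y + 2 * t₀), (P (0, x) + M (0, x)) := by
    have := intervalIntegral.smul_integral_comp_add_mul (a := -1) (b := 1)
      (fun x => P (0, x) + M (0, x)) t₀ (y + t₀)
    rw [show y + t₀ + t₀ * -1 = y by ring, show y + t₀ + t₀ * 1 = y + 2 * t₀ by ring] at this
    rw [← this, smul_eq_mul, ← intervalIntegral.integral_const_mul]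
    simp [hf, hΦ]
  rw [e1, e2, e3, e4] at main
  linarith

theorem deriv_fst_add_mul_deriv_snd {u : ℝ → ℝ → ℂ} (hu : ContDiff ℝ 1 (Function.uncurry u))
    (c t x : ℝ) :
    deriv (fun t' => u t' x) t + c * deriv (fun x' => u t x') x
      = fderiv ℝ (Function.uncurry u) (t, x) (1, c) := by
  have hd := (hu.differentiable one_ne_zero (t, x)).hasFDerivAt
  have h1 := (hd.comp_hasDerivAt t ((hasDerivAt_id t).prodMk (hasDerivAt_const t x))).deriv
  have h2 := (hd.comp_hasDerivAt x ((hasDerivAt_const x t).prodMk (hasDerivAt_id x))).deriv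
  change deriv (fun t' => u t' x) t = _ at h1
  change deriv (fun x' => u t x') x = _ at h2
  rw [h1, h2, show ((1 : ℝ), c) = ((1 : ℝ), (0 : ℝ)) + c • ((0 : ℝ), (1 : ℝ)) by simp,
    map_add, map_smul, Complex.real_smul]

theorem inner_transport {m a : ℝ} {u v d : ℂ} (h : Complex.I * d = m * v - a * u) :
    inner ℝ u d = m * (u.re * v.im - u.im * v.re) := by
  have hr := congrArg Complex.re h
  have hi := congrArg Complex.im h
  simp at hr hi
  simp only [Complex.inner, Complex.mul_re, Complex.conj_re, Complex.conj_im]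
  linear_combination u.re * hi - u.im * hr

/-- A solution of the transport equation with zero data is controlled by the `L²` norm of the
source along the characteristic; the real potential `a` does not contribute. -/
theorem norm_sq_le_of_transport {m t₀ : ℝ} (ht₀ : 0 ≤ t₀) {W W' V : ℝ → ℂ} {a : ℝ → ℝ}
    (hV : Continuous V) (hW : ∀ s, HasDerivAt W (W' s) s)
    (h : ∀ s ∈ Set.Icc 0 t₀, Complex.I * W' s = m * V s - a s * W s) (h0 : W 0 = 0) :
    ‖W t₀‖ ^ 2 ≤ Real.exp t₀ * m ^ 2 * ∫ s in (0)..t₀, ‖V s‖ ^ 2 := by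
  set N : ℝ → ℝ := fun s => Real.exp (-s) * ‖W s‖ ^ 2 - m ^ 2 * ∫ r in (0)..s, ‖V r‖ ^ 2
  have hN : ∀ s, HasDerivAt N ((Real.exp (-s) * -1) * ‖W s‖ ^ 2
      + Real.exp (-s) * (2 * inner ℝ (W s) (W' s)) - m ^ 2 * ‖V s‖ ^ 2) s := fun s =>
    ((((hasDerivAt_id s).neg).exp).mul (hW s).norm_sq).sub
      ((intervalIntegral.integral_hasDerivAt_right
        ((hV.norm.pow 2).intervalIntegrable _ _)
        ((hV.norm.pow 2).stronglyMeasurableAtFilter _ _)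
        (hV.norm.pow 2).continuousAt).const_mul _)
  have hanti : AntitoneOn N (Set.Icc 0 t₀) := by
    refine antitoneOn_of_deriv_nonpos (convex_Icc _ _)
      (fun s _ => (hN s).continuousAt.continuousWithinAt)
      (fun s _ => (hN s).differentiableAt.differentiableWithinAt) fun s hs => ?_
    rw [interior_Icc] at hs
    rw [(hN s).deriv, inner_transport (h s (Set.Ioo_subset_Icc_self hs))]
    have hE0 := Real.exp_pos (-s)
    have hE1 : Real.exp (-s) ≤ 1 := Real.exp_le_one_iff.mpr (by linarith [hs.1])
    rw [← Complex.normSq_eq_norm_sq, ← Complex.normSq_eq_norm_sq, Complex.normSq_apply,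
      Complex.normSq_apply]
    set A := (W s).re
    set B := (W s).im
    set c := (V s).re
    set d := (V s).im
    have k1 : 0 ≤ Real.exp (-s) * ((A - m * d) ^ 2 + (B + m * c) ^ 2) := by positivity
    have k2 : 0 ≤ (1 - Real.exp (-s)) * (m ^ 2 * (c ^ 2 + d ^ 2)) :=
      mul_nonneg (by linarith) (by positivity)
    nlinarith
  have hle := hanti (Set.left_mem_Icc.2 ht₀) (Set.right_mem_Icc.2 ht₀) ht₀
  simp only [N, h0, intervalIntegral.integral_same] at hle
  norm_num at hle
  have := mul_le_mul_of_nonneg_left hle (Real.exp_pos t₀).le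
  rw [← mul_assoc, ← Real.exp_add] at this
  simpa [mul_assoc] using this

theorem norm_sq_massive_part_le {m t₀ : ℝ} (ht₀ : 0 ≤ t₀) {p q w : ℝ → ℝ → ℂ} {a b : ℝ → ℝ → ℝ}
    (hp : ContDiff ℝ 1 (Function.uncurry p)) (hq : ContDiff ℝ 1 (Function.uncurry q))
    (hw : ContDiff ℝ 1 (Function.uncurry w))
    (hpi : Integrable fun x => ‖p 0 x‖ ^ 2) (hqi : Integrable fun x => ‖q 0 x‖ ^ 2)
    (ep : ∀ t x : ℝ, t ∈ Set.Icc 0 t₀ →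
      Complex.I * (deriv (fun t' => p t' x) t + deriv (fun x' => p t x') x)
        = m * q t x - a t x * p t x)
    (eq : ∀ t x : ℝ, t ∈ Set.Icc 0 t₀ →
      Complex.I * (deriv (fun t' => q t' x) t - deriv (fun x' => q t x') x)
        = m * p t x - b t x * q t x)
    (ew : ∀ t x : ℝ, t ∈ Set.Icc 0 t₀ →
      Complex.I * (deriv (fun t' => w t' x) t + deriv (fun x' => w t x') x)
        = m * q t x - a t x * w t x)
    (w0 : ∀ x, w 0 x = 0) (x : ℝ) :
    ‖w t₀ x‖ ^ 2 ≤ Real.exp t₀ * m ^ 2 * ((∫ x, ‖p 0 x‖ ^ 2) + ∫ x, ‖q 0 x‖ ^ 2) := by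
  have dp := fun t x => deriv_fst_add_mul_deriv_snd hp 1 t x
  have dq := fun t x => deriv_fst_add_mul_deriv_snd hq (-1) t x
  have dw := fun t x => deriv_fst_add_mul_deriv_snd hw 1 t x
  simp only [Complex.ofReal_one, Complex.ofReal_neg, one_mul, neg_mul, ← sub_eq_add_neg]
    at dp dq dw
  simp only [dp] at ep
  simp only [dq] at eq
  simp only [dw] at ew
  obtain ⟨y, rfl⟩ : ∃ y, x = y + t₀ := ⟨x - t₀, by ring⟩
  have hchar : ∀ s : ℝ, HasDerivAt (fun s : ℝ => (s, y + s)) ((1 : ℝ), (1 : ℝ)) s := fun s =>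
    (hasDerivAt_id s).prodMk ((hasDerivAt_id s).const_add y)
  have hW := fun s : ℝ =>
    (hw.differentiable one_ne_zero (s, y + s)).hasFDerivAt.comp_hasDerivAt s (hchar s)
  have h1 := norm_sq_le_of_transport (m := m) ht₀ (W := fun s => w s (y + s))
    (V := fun s => q s (y + s)) (a := fun s => a s (y + s))
    (hq.continuous.comp (f := fun s : ℝ => (s, y + s)) (by fun_prop))
    hW (fun s hs => ew s (y + s) hs) (w0 _)
  have hpd := hp.differentiable one_ne_zero
  have hqd := hq.differentiable one_ne_zero
  have h2 := integral_lightCone_sides_eq (hp.norm_sq ℝ) (hq.norm_sq ℝ) ht₀ (by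
    intro t x ht
    have fp := (hpd (t, x)).hasFDerivAt.norm_sq.fderiv
    have fq := (hqd (t, x)).hasFDerivAt.norm_sq.fderiv
    change fderiv ℝ (fun z => ‖Function.uncurry p z‖ ^ 2) (t, x) = _ at fp
    change fderiv ℝ (fun z => ‖Function.uncurry q z‖ ^ 2) (t, x) = _ at fq
    rw [fp, fq]
    have ip := inner_transport (ep t x ht)
    have iq := inner_transport (eq t x ht)
    simp only [_root_.smul_apply, ContinuousLinearMap.comp_apply, innerSL_apply_apply,
      Function.uncurry_apply_pair, nsmul_eq_mul, Nat.cast_ofNat, ip, iq]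
    ring) y
  simp only [Function.uncurry_apply_pair] at h2
  have h3 : 0 ≤ ∫ t in (0)..t₀, ‖p t (y + 2 * t₀ - t)‖ ^ 2 :=
    intervalIntegral.integral_nonneg ht₀ fun _ _ => by positivity
  have h4 : 0 ≤ ∫ t in (0)..t₀, ‖q t (y + t)‖ ^ 2 :=
    intervalIntegral.integral_nonneg ht₀ fun _ _ => by positivity
  have h5 : (∫ x in y..(y + 2 * t₀), (‖p 0 x‖ ^ 2 + ‖q 0 x‖ ^ 2))
      ≤ (∫ x, ‖p 0 x‖ ^ 2) + ∫ x, ‖q 0 x‖ ^ 2 := by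
    rw [← integral_add hpi hqi, intervalIntegral.integral_of_le (by linarith)]
    exact setIntegral_le_integral (hpi.add hqi) (ae_of_all _ fun x => by positivity)
  refine h1.trans (mul_le_mul_of_nonneg_left ?_ (by positivity))
  linarith

theorem HasCompactSupport.integrable_norm_sq {f : ℝ → ℂ} (hs : HasCompactSupport f)
    (hf : Continuous f) : Integrable fun x => ‖f x‖ ^ 2 :=
  (memLp_two_iff_integrable_sq_norm hf.aestronglyMeasurable).1
    (hf.memLp_of_hasCompactSupport hs)

theorem HasCompactSupport.eLpNorm_two_eq {f : ℝ → ℂ} (hs : HasCompactSupport f)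
    (hf : Continuous f) : eLpNorm f 2 volume = ENNReal.ofReal √(∫ x, ‖f x‖ ^ 2) := by
  rw [(hf.memLp_of_hasCompactSupport hs).eLpNorm_eq_integral_rpow_norm two_ne_zero
    ENNReal.ofNat_ne_top, Real.sqrt_eq_rpow]
  norm_num

/-- Uniform bound on the massive part of solutions to the null-coordinate
Chern–Simons–Dirac Dirac equations: the parts `u^N_±` with vanishing data satisfy
`sup_{|t| ≤ T} (‖u^N₊(t)‖_{L^∞} + ‖u^N₋(t)‖_{L^∞}) ≤ C(T,m) (‖f₊‖_{L²} + ‖f₋‖_{L²})`. -/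
theorem stmt_16 (m T : ℝ) (hT : 0 < T) :
    ∃ C : ℝ, 0 < C ∧
      ∀ (up um uNp uNm : ℝ → ℝ → ℂ) (Ap Am : ℝ → ℝ → ℝ),
        ContDiff ℝ 1 (Function.uncurry up) → ContDiff ℝ 1 (Function.uncurry um) →
        (∀ t : ℝ, HasCompactSupport (up t)) → (∀ t : ℝ, HasCompactSupport (um t)) →
        Continuous (Function.uncurry Ap) → Continuous (Function.uncurry Am) →
        (∀ t x : ℝ, t ∈ Set.Icc (-T) T →
          Complex.I * (deriv (fun t' => up t' x) t + deriv (fun x' => up t x') x)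
            = (m : ℂ) * um t x - (Am t x : ℂ) * up t x) →
        (∀ t x : ℝ, t ∈ Set.Icc (-T) T →
          Complex.I * (deriv (fun t' => um t' x) t - deriv (fun x' => um t x') x)
            = (m : ℂ) * up t x - (Ap t x : ℂ) * um t x) →
        ContDiff ℝ 1 (Function.uncurry uNp) → ContDiff ℝ 1 (Function.uncurry uNm) →
        (∀ t x : ℝ, t ∈ Set.Icc (-T) T →
          Complex.I * (deriv (fun t' => uNp t' x) t + deriv (fun x' => uNp t x') x)
            = (m : ℂ) * um t x - (Am t x : ℂ) * uNp t x) →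
        (∀ t x : ℝ, t ∈ Set.Icc (-T) T →
          Complex.I * (deriv (fun t' => uNm t' x) t - deriv (fun x' => uNm t x') x)
            = (m : ℂ) * up t x - (Ap t x : ℂ) * uNm t x) →
        (∀ x : ℝ, uNp 0 x = 0) → (∀ x : ℝ, uNm 0 x = 0) →
        ∀ t ∈ Set.Icc (-T) T,
          eLpNorm (uNp t) ⊤ volume + eLpNorm (uNm t) ⊤ volume
            ≤ ENNReal.ofReal C * (eLpNorm (up 0) 2 volume + eLpNorm (um 0) 2 volume) := by
  refine ⟨2 * (Real.exp T * (|m| + 1)), by positivity, ?_⟩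
  intro up um uNp uNm Ap Am hup hum sup sum _ _ eup eum huNp huNm euNp euNm zNp zNm t ht
  have hup0 : Continuous (up 0) := hup.continuous.comp (f := fun x : ℝ => ((0 : ℝ), x)) (by fun_prop)
  have hum0 : Continuous (um 0) := hum.continuous.comp (f := fun x : ℝ => ((0 : ℝ), x)) (by fun_prop)
  have hpi := (sup 0).integrable_norm_sq hup0
  have hmi := (sum 0).integrable_norm_sq hum0
  rw [(sup 0).eLpNorm_two_eq hup0, (sum 0).eLpNorm_two_eq hum0]
  set a := ∫ x, ‖up 0 x‖ ^ 2 with ha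
  set b := ∫ x, ‖um 0 x‖ ^ 2 with hb
  have ha0 : 0 ≤ a := integral_nonneg fun _ => by positivity
  have hb0 : 0 ≤ b := integral_nonneg fun _ => by positivity
  have hb' : ∫ x, ‖um 0 (-x)‖ ^ 2 = b := integral_neg_eq_self (fun x => ‖um 0 x‖ ^ 2) volume
  have ha' : ∫ x, ‖up 0 (-x)‖ ^ 2 = a := integral_neg_eq_self (fun x => ‖up 0 x‖ ^ 2) volume
  have refl_x : ∀ {u : ℝ → ℝ → ℂ}, ContDiff ℝ 1 (Function.uncurry u) →
      ContDiff ℝ 1 (Function.uncurry fun t x => u t (-x)) := fun hu =>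
    hu.comp (contDiff_fst.prodMk contDiff_snd.neg)
  have refl_t : ∀ {u : ℝ → ℝ → ℂ}, ContDiff ℝ 1 (Function.uncurry u) →
      ContDiff ℝ 1 (Function.uncurry fun t x => u (-t) x) := fun hu =>
    hu.comp (contDiff_fst.neg.prodMk contDiff_snd)
  have dneg : ∀ (f : ℝ → ℂ) (x : ℝ), deriv (fun y => f (-y)) x = -deriv f (-x) := deriv_comp_neg
  have key : ∀ x, ‖uNp t x‖ ^ 2 ≤ Real.exp |t| * m ^ 2 * (a + b) ∧
      ‖uNm t x‖ ^ 2 ≤ Real.exp |t| * m ^ 2 * (a + b) := by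
    intro x
    rcases le_total 0 t with h0 | h0
    · have hsub : ∀ s ∈ Set.Icc 0 t, s ∈ Set.Icc (-T) T := fun s hs =>
        ⟨by linarith [hs.1], hs.2.trans ht.2⟩
      rw [abs_of_nonneg h0]
      constructor
      · exact norm_sq_massive_part_le h0 hup hum huNp hpi hmi
          (fun s x hs => eup s x (hsub s hs)) (fun s x hs => eum s x (hsub s hs))
          (fun s x hs => euNp s x (hsub s hs)) zNp x
      · have := norm_sq_massive_part_le (m := m) (a := fun t x => Ap t (-x))
          (b := fun t x => Am t (-x)) h0 (refl_x hum) (refl_x hup) (refl_x huNm)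
          hmi.comp_neg hpi.comp_neg
          (fun s x hs => by simpa only [dneg, ← sub_eq_add_neg] using eum s (-x) (hsub s hs))
          (fun s x hs => by simpa only [dneg, sub_neg_eq_add] using eup s (-x) (hsub s hs))
          (fun s x hs => by simpa only [dneg, ← sub_eq_add_neg] using euNm s (-x) (hsub s hs))
          (fun x => zNm (-x)) (-x)
        rwa [ha', hb', neg_neg, add_comm b a] at this
    · have hsub : ∀ s ∈ Set.Icc 0 (-t), -s ∈ Set.Icc (-T) T := fun s hs =>
        ⟨by linarith [hs.2, ht.1], by linarith [hs.1]⟩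
      rw [abs_of_nonpos h0]
      constructor
      · have := norm_sq_massive_part_le (m := -m) (a := fun t x => -Am (-t) (-x))
          (b := fun t x => -Ap (-t) (-x)) (neg_nonneg.2 h0) (refl_t (refl_x hup))
          (refl_t (refl_x hum)) (refl_t (refl_x huNp))
          (by simpa using hpi.comp_neg) (by simpa using hmi.comp_neg)
          (fun s x hs => by
            rw [dneg (fun t => up t (-x)), dneg (up (-s))]
            push_cast
            linear_combination -eup (-s) (-x) (hsub s hs))
          (fun s x hs => by
            rw [dneg (fun t => um t (-x)), dneg (um (-s))]
            push_cast
            linear_combination -eum (-s) (-x) (hsub s hs))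
          (fun s x hs => by
            rw [dneg (fun t => uNp t (-x)), dneg (uNp (-s))]
            push_cast
            linear_combination -euNp (-s) (-x) (hsub s hs))
          (fun x => by simpa using zNp (-x)) (-x)
        rwa [neg_zero, ha', hb', neg_neg, neg_neg, neg_sq] at this
      · have := norm_sq_massive_part_le (m := -m) (a := fun t x => -Ap (-t) x)
          (b := fun t x => -Am (-t) x) (neg_nonneg.2 h0) (refl_t hum)
          (refl_t hup) (refl_t huNm) (by simpa using hmi) (by simpa using hpi)
          (fun s x hs => by
            rw [dneg (fun t => um t x)]
            push_cast
            linear_combination -eum (-s) x (hsub s hs))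
          (fun s x hs => by
            rw [dneg (fun t => up t x)]
            push_cast
            linear_combination -eup (-s) x (hsub s hs))
          (fun s x hs => by
            rw [dneg (fun t => uNm t x)]
            push_cast
            linear_combination -euNm (-s) x (hsub s hs))
          (fun x => by simpa using zNm x) x
        rwa [neg_zero, ← ha, ← hb, neg_neg, neg_sq, add_comm b a] at this
  have bound : ∀ z : ℂ, ‖z‖ ^ 2 ≤ Real.exp |t| * m ^ 2 * (a + b) →
      ‖z‖ ≤ Real.exp T * (|m| + 1) * (√a + √b) := by
    intro z hz
    refine (pow_le_pow_iff_left₀ (norm_nonneg z) (by positivity) two_ne_zero).1 (hz.trans ?_)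
    have hE : Real.exp |t| ≤ Real.exp T ^ 2 := by
      rw [← Real.exp_nat_mul]
      exact Real.exp_le_exp.2 (by push_cast; linarith [abs_le.2 ht])
    have hm : m ^ 2 ≤ (|m| + 1) ^ 2 := by nlinarith [sq_abs m, abs_nonneg m]
    have hab : a + b ≤ (√a + √b) ^ 2 := by
      nlinarith [Real.sq_sqrt ha0, Real.sq_sqrt hb0,
        mul_nonneg (Real.sqrt_nonneg a) (Real.sqrt_nonneg b)]
    rw [mul_pow, mul_pow]
    gcongr
  rw [eLpNorm_exponent_top, eLpNorm_exponent_top, ← ENNReal.ofReal_add (by positivity) (by positivity),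
    ← ENNReal.ofReal_mul (by positivity), show 2 * (Real.exp T * (|m| + 1)) * (√a + √b)
      = Real.exp T * (|m| + 1) * (√a + √b) + Real.exp T * (|m| + 1) * (√a + √b) by ring,
    ENNReal.ofReal_add (by positivity) (by positivity)]
  exact add_le_add (eLpNormEssSup_le_of_ae_bound (ae_of_all _ fun x => bound _ (key x).1))
    (eLpNormEssSup_le_of_ae_bound (ae_of_all _ fun x => bound _ (key x).2))
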